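/- arXiv:2109.08398 — 2 statements merged into one kernel-verified Lean document; each statement's English description precedes it below -/
import Mathlib

section
/- Shifting a separation does not increase its order: for every separation (A,B) of X, |A,B|_X ≥ |A^▷_B, B^▷_A|_Y, and symmetrically, for every separation (C,D) of Y, |C,D|_Y ≥ |C^◁_D, D^◁_C|_X. -/
open Finset

namespace BipSep

variable {X Y : Type*} [Fintype X] [Fintype Y] [DecidableEq X] [DecidableEq Y]

/-- `|N(y) ∩ A|`: the number of neighbours of `y` in `A ⊆ X`, where the bipartite graph is
given by the adjacency relation `R : X → Y → Prop`. -/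
def nX (R : X → Y → Prop) [∀ x y, Decidable (R x y)] (y : Y) (A : Finset X) : ℕ :=
  (A.filter fun x => R x y).card

/-- `|N(x) ∩ C|` for `C ⊆ Y`. -/
def nY (R : X → Y → Prop) [∀ x y, Decidable (R x y)] (x : X) (C : Finset Y) : ℕ :=
  (C.filter fun y => R x y).card

/-- The order `|A,B|_X` of a separation `(A,B)` of `X`. -/
def ordX (R : X → Y → Prop) [∀ x y, Decidable (R x y)] (A B : Finset X) : ℚ :=
  ∑ y : Y, ((min (nX R y A) (nX R y B) : ℚ) - (nX R y (A ∩ B) : ℚ) / 2)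

/-- The order `|C,D|_Y` of a separation `(C,D)` of `Y`. -/
def ordY (R : X → Y → Prop) [∀ x y, Decidable (R x y)] (C D : Finset Y) : ℚ :=
  ∑ x : X, ((min (nY R x C) (nY R x D) : ℚ) - (nY R x (C ∩ D) : ℚ) / 2)

/-- `A^▷_B := {y ∈ Y : |N(y) ∩ A| ≥ |N(y) ∩ B|}`. -/
def shiftR1 (R : X → Y → Prop) [∀ x y, Decidable (R x y)] (A B : Finset X) : Finset Y :=
  univ.filter fun y => nX R y B ≤ nX R y A

/-- `B^▷_A := {y ∈ Y : |N(y) ∩ A| ≤ |N(y) ∩ B|}`. -/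
def shiftR2 (R : X → Y → Prop) [∀ x y, Decidable (R x y)] (A B : Finset X) : Finset Y :=
  univ.filter fun y => nX R y A ≤ nX R y B

/-- `C^◁_D := {x ∈ X : |N(x) ∩ C| ≥ |N(x) ∩ D|}`. -/
def shiftL1 (R : X → Y → Prop) [∀ x y, Decidable (R x y)] (C D : Finset Y) : Finset X :=
  univ.filter fun x => nY R x D ≤ nY R x C

/-- `D^◁_C := {x ∈ X : |N(x) ∩ C| ≤ |N(x) ∩ D|}`. -/
def shiftL2 (R : X → Y → Prop) [∀ x y, Decidable (R x y)] (C D : Finset Y) : Finset X :=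
  univ.filter fun x => nY R x C ≤ nY R x D

instance (R : X → Y → Prop) [∀ x y, Decidable (R x y)] :
    DecidablePred fun p : X × Y => R p.1 p.2 :=
  fun p => inferInstanceAs (Decidable (R p.1 p.2))

/-- The edge set of the bipartite graph with adjacency relation `R`: an edge is a pair
`(x,y)` with `x ∈ X`, `y ∈ Y` and `x` adjacent to `y`. -/
abbrev Edge (R : X → Y → Prop) := {p : X × Y // R p.1 p.2}

/-- `|E(x) ∩ C|` for a set `C` of edges. -/
def eX (R : X → Y → Prop) [∀ x y, Decidable (R x y)] (x : X) (C : Finset (Edge R)) : ℕ :=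
  (C.filter fun e => e.1.1 = x).card

/-- `|E(y) ∩ C|` for a set `C` of edges. -/
def eY (R : X → Y → Prop) [∀ x y, Decidable (R x y)] (y : Y) (C : Finset (Edge R)) : ℕ :=
  (C.filter fun e => e.1.2 = y).card

/-- The order `|C,D|_E` of a separation `(C,D)` of the edge set `E`. -/
def ordE (R : X → Y → Prop) [∀ x y, Decidable (R x y)] (C D : Finset (Edge R)) : ℚ :=
  (∑ x : X, ((min (eX R x C) (eX R x D) : ℚ) - (eX R x (C ∩ D) : ℚ) / 2)) +
    ∑ y : Y, ((min (eY R y C) (eY R y D) : ℚ) - (eY R y (C ∩ D) : ℚ) / 2)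

/-- `C^◀_D := {x ∈ X : |E(x) ∩ C| ≥ |E(x) ∩ D|}`. -/
def bshift1 (R : X → Y → Prop) [∀ x y, Decidable (R x y)] (C D : Finset (Edge R)) : Finset X :=
  univ.filter fun x => eX R x D ≤ eX R x C

/-- `D^◀_C := {x ∈ X : |E(x) ∩ C| ≤ |E(x) ∩ D|}`. -/
def bshift2 (R : X → Y → Prop) [∀ x y, Decidable (R x y)] (C D : Finset (Edge R)) : Finset X :=
  univ.filter fun x => eX R x C ≤ eX R x D

/-- `E(A)`: the set of edges with an endpoint in `A ⊆ X`. -/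
def edgesOf (R : X → Y → Prop) [∀ x y, Decidable (R x y)] (A : Finset X) : Finset (Edge R) :=
  univ.filter fun e => e.1.1 ∈ A

/-- `|E(S,T)|`: the number of edges with `X`-endpoint in `T` and `Y`-endpoint in `S`. -/
def eCount (R : X → Y → Prop) [∀ x y, Decidable (R x y)] (T : Finset X) (S : Finset Y) : ℕ :=
  (univ.filter fun e : Edge R => e.1.1 ∈ T ∧ e.1.2 ∈ S).card

/-- `S_k`: the set of oriented separations of order `< k`, with respect to the
order function `ord`. -/
def Sk {V : Type*} [Fintype V] [DecidableEq V] (ord : Finset V → Finset V → ℚ) (k : ℚ) :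
    Set (Finset V × Finset V) :=
  {p | p.1 ∪ p.2 = univ ∧ ord p.1 p.2 < k}

/-- A tangle of `S_k`: a set of oriented separations, all of order `< k`, containing exactly
one of `(A,B)`, `(B,A)` for every separation of order `< k`, such that no three of its
members have their left-hand sides covering the whole ground set. -/
def IsTangle {V : Type*} [Fintype V] [DecidableEq V] (ord : Finset V → Finset V → ℚ)
    (k : ℚ) (τ : Set (Finset V × Finset V)) : Prop :=
  (∀ p ∈ τ, p.1 ∪ p.2 = univ ∧ ord p.1 p.2 < k) ∧
  (∀ A B : Finset V, A ∪ B = univ → ord A B < k → ((A, B) ∈ τ ↔ (B, A) ∉ τ)) ∧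
  ∀ p₁ ∈ τ, ∀ p₂ ∈ τ, ∀ p₃ ∈ τ, p₁.1 ∪ p₂.1 ∪ p₃.1 ≠ univ

/-- A profile of `S_k`: an orientation of `S_k` that is consistent and closed under
the profile property. -/
def IsProfile {V : Type*} [Fintype V] [DecidableEq V] (ord : Finset V → Finset V → ℚ)
    (k : ℚ) (P : Set (Finset V × Finset V)) : Prop :=
  (∀ p ∈ P, p.1 ∪ p.2 = univ ∧ ord p.1 p.2 < k) ∧
  (∀ A B : Finset V, A ∪ B = univ → ord A B < k → ((A, B) ∈ P ↔ (B, A) ∉ P)) ∧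
  (∀ A₁ B₁ A₂ B₂ : Finset V, A₁ ⊆ A₂ → B₂ ⊆ B₁ →
    ¬((A₁ = A₂ ∧ B₁ = B₂) ∨ (A₁ = B₂ ∧ B₁ = A₂)) →
    ¬((B₁, A₁) ∈ P ∧ (A₂, B₂) ∈ P)) ∧
  ∀ p₁ ∈ P, ∀ p₂ ∈ P, (p₁.2 ∩ p₂.2, p₁.1 ∪ p₂.1) ∉ P

/-- A regular profile: a profile containing no separation of the form `(V,B)`. -/
def IsRegularProfile {V : Type*} [Fintype V] [DecidableEq V] (ord : Finset V → Finset V → ℚ)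
    (k : ℚ) (P : Set (Finset V × Finset V)) : Prop :=
  IsProfile ord k P ∧ ∀ B : Finset V, (univ, B) ∉ P

/-- `^▷τ`: the separations `(C,D)` of `Y` whose shift `(C,D)^◁` lies in `τ`. -/
def pullY (R : X → Y → Prop) [∀ x y, Decidable (R x y)] (τ : Set (Finset X × Finset X)) :
    Set (Finset Y × Finset Y) :=
  {q | q.1 ∪ q.2 = univ ∧ (shiftL1 R q.1 q.2, shiftL2 R q.1 q.2) ∈ τ}

/-- `^◁τ`: the separations `(A,B)` of `X` whose shift `(A,B)^▷` lies in `τ`. -/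
def pullX (R : X → Y → Prop) [∀ x y, Decidable (R x y)] (τ : Set (Finset Y × Finset Y)) :
    Set (Finset X × Finset X) :=
  {p | p.1 ∪ p.2 = univ ∧ (shiftR1 R p.1 p.2, shiftR2 R p.1 p.2) ∈ τ}

/-- `τ_E`: the separations `(C,D)` of `E` whose shift `(C,D)^◀` lies in `τ`. -/
def pullE (R : X → Y → Prop) [∀ x y, Decidable (R x y)] (τ : Set (Finset X × Finset X)) :
    Set (Finset (Edge R) × Finset (Edge R)) :=
  {q | q.1 ∪ q.2 = univ ∧ (bshift1 R q.1 q.2, bshift2 R q.1 q.2) ∈ τ}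

/-- `τ_X := {(C,D)^◀ : (C,D) ∈ τ}`. -/
def pushX (R : X → Y → Prop) [∀ x y, Decidable (R x y)]
    (τ : Set (Finset (Edge R) × Finset (Edge R))) : Set (Finset X × Finset X) :=
  {p | ∃ q ∈ τ, (bshift1 R q.1 q.2, bshift2 R q.1 q.2) = p}


omit [Fintype X] [Fintype Y] [DecidableEq Y] in
theorem nX_union_add_nX_inter (R : X → Y → Prop) [∀ x y, Decidable (R x y)] (y : Y)
    (A B : Finset X) : nX R y (A ∪ B) + nX R y (A ∩ B) = nX R y A + nX R y B := by
  simp only [nX, filter_union, filter_inter_distrib, card_union_add_card_inter]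

omit [DecidableEq Y] in
theorem ordX_eq (R : X → Y → Prop) [∀ x y, Decidable (R x y)] {A B : Finset X}
    (h : A ∪ B = univ) :
    ordX R A B = ∑ y : Y, ((nX R y univ : ℚ) - |(nX R y A : ℚ) - nX R y B|) / 2 := by
  refine sum_congr rfl fun y _ => ?_
  have key : (nX R y univ : ℚ) + nX R y (A ∩ B) = nX R y A + nX R y B := by
    rw [← h]
    exact_mod_cast nX_union_add_nX_inter R y A B
  linarith [min_add_max (nX R y A : ℚ) (nX R y B),
    max_sub_min_eq_abs' (nX R y A : ℚ) (nX R y B)]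

omit [DecidableEq X] in
theorem ordY_eq (R : X → Y → Prop) [∀ x y, Decidable (R x y)] {C D : Finset Y}
    (h : C ∪ D = univ) :
    ordY R C D = ∑ x : X, ((nY R x univ : ℚ) - |(nY R x C : ℚ) - nY R x D|) / 2 :=
  ordX_eq (fun y x => R x y) h

omit [DecidableEq X] [DecidableEq Y] in
theorem sum_nX_univ (R : X → Y → Prop) [∀ x y, Decidable (R x y)] :
    ∑ y : Y, (nX R y univ : ℚ) = ∑ x : X, (nY R x univ : ℚ) := by
  simp only [nX, nY, card_filter, Nat.cast_sum]
  exact sum_comm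

omit [Fintype Y] [DecidableEq Y] in
theorem nX_sub_nX (R : X → Y → Prop) [∀ x y, Decidable (R x y)] (y : Y) (A B : Finset X) :
    (nX R y A : ℚ) - nX R y B = ∑ x : X, if R x y then
      (if x ∈ A then (1 : ℚ) else 0) - (if x ∈ B then 1 else 0) else 0 := by
  have key (S : Finset X) :
      (nX R y S : ℚ) = ∑ x : X, if R x y then (if x ∈ S then (1 : ℚ) else 0) else 0 := by
    rw [← sum_filter, sum_boole, nX, filter_filter]
    congr 2
    ext x
    simp [and_comm]
  rw [key, key, ← sum_sub_distrib]
  refine sum_congr rfl fun x _ => ?_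
  split_ifs <;> simp

omit [Fintype X] [DecidableEq X] in
theorem nY_sub_nY (R : X → Y → Prop) [∀ x y, Decidable (R x y)] (x : X) (C D : Finset Y) :
    (nY R x C : ℚ) - nY R x D = ∑ y : Y, if R x y then
      (if y ∈ C then (1 : ℚ) else 0) - (if y ∈ D then 1 else 0) else 0 :=
  nX_sub_nX (fun y x => R x y) x C D

omit [Fintype X] [DecidableEq X] in
theorem shiftR1_union_shiftR2 (R : X → Y → Prop) [∀ x y, Decidable (R x y)]
    (A B : Finset X) : shiftR1 R A B ∪ shiftR2 R A B = univ := by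
  ext y
  simp [shiftR1, shiftR2, le_total]

/-- The total imbalance does not decrease under shifting. -/
theorem sum_abs_nX_sub_le (R : X → Y → Prop) [∀ x y, Decidable (R x y)] (A B : Finset X) :
    ∑ y : Y, |(nX R y A : ℚ) - nX R y B| ≤
      ∑ x : X, |(nY R x (shiftR1 R A B) : ℚ) - nY R x (shiftR2 R A B)| := by
  set f : X → ℚ := fun x => (if x ∈ A then 1 else 0) - (if x ∈ B then 1 else 0) with hf
  set g : Y → ℚ := fun y =>
    (if y ∈ shiftR1 R A B then 1 else 0) - (if y ∈ shiftR2 R A B then 1 else 0) with hg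
  have hfle (x : X) : |f x| ≤ 1 := by
    simp only [hf]
    split_ifs <;> norm_num
  have habs (y : Y) :
      |(nX R y A : ℚ) - nX R y B| = g y * ((nX R y A : ℚ) - nX R y B) := by
    simp only [hg, shiftR1, shiftR2, mem_filter, mem_univ, true_and]
    rcases lt_trichotomy (nX R y A) (nX R y B) with h | h | h
    · have h' : (nX R y A : ℚ) < nX R y B := by exact_mod_cast h
      rw [if_neg h.not_ge, if_pos h.le, abs_of_neg (sub_neg.2 h')]
      ring
    · simp [h]
    · have h' : (nX R y B : ℚ) < nX R y A := by exact_mod_cast h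
      rw [if_pos h.le, if_neg h.not_ge, abs_of_pos (sub_pos.2 h')]
      ring
  calc ∑ y : Y, |(nX R y A : ℚ) - nX R y B|
      = ∑ y : Y, ∑ x : X, g y * (if R x y then f x else 0) := by
        refine sum_congr rfl fun y _ => ?_
        rw [habs, nX_sub_nX, mul_sum]
    _ = ∑ x : X, f x * ((nY R x (shiftR1 R A B) : ℚ) - nY R x (shiftR2 R A B)) := by
        rw [sum_comm]
        simp only [nY_sub_nY R, mul_sum]
        refine sum_congr rfl fun x _ => sum_congr rfl fun y _ => ?_
        by_cases h : R x y
        · simp only [if_pos h]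
          exact mul_comm _ _
        · simp only [if_neg h, mul_zero]
    _ ≤ ∑ x : X, |(nY R x (shiftR1 R A B) : ℚ) - nY R x (shiftR2 R A B)| := by
        refine sum_le_sum fun x _ => (le_abs_self _).trans ?_
        rw [abs_mul]
        exact mul_le_of_le_one_left (abs_nonneg _) (hfle x)

theorem ordY_shift_le (R : X → Y → Prop) [∀ x y, Decidable (R x y)] {A B : Finset X}
    (h : A ∪ B = univ) : ordY R (shiftR1 R A B) (shiftR2 R A B) ≤ ordX R A B := by
  rw [ordX_eq R h, ordY_eq R (shiftR1_union_shiftR2 R A B), ← sum_div, ← sum_div,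
    sum_sub_distrib, sum_sub_distrib, sum_nX_univ]
  linarith [sum_abs_nX_sub_le R A B]

/-- Shifting a separation does not increase its order, in either direction. -/
theorem shift_order_le (R : X → Y → Prop) [∀ x y, Decidable (R x y)] :
    (∀ A B : Finset X, A ∪ B = univ →
      ordY R (shiftR1 R A B) (shiftR2 R A B) ≤ ordX R A B) ∧
    (∀ C D : Finset Y, C ∪ D = univ →
      ordX R (shiftL1 R C D) (shiftL2 R C D) ≤ ordY R C D) :=
  ⟨fun _ _ h => ordY_shift_le R h, fun _ _ h => ordY_shift_le (fun y x => R x y) h⟩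

end BipSep
end

section
/- Let k > 0, assume that every vertex of G is incident with at least one edge and that G has at least 32k edges. Let τ be a tangle of S_{16k}(X), let τ' := ^▷τ ∩ S_{4k}(Y), and let τ'' := ^◁τ' ∩ S_k(X). Then τ'' ⊆ τ. -/
open Finset

namespace BipSep

variable {X Y : Type*} [Fintype X] [Fintype Y] [DecidableEq X] [DecidableEq Y]

omit [Fintype X] [Fintype Y] [DecidableEq X] [DecidableEq Y] in
lemma nX_mono (R : X → Y → Prop) [∀ x y, Decidable (R x y)] (y : Y) {A B : Finset X}
    (h : A ⊆ B) : nX R y A ≤ nX R y B :=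
  card_le_card (filter_subset_filter _ h)

omit [Fintype X] [Fintype Y] [DecidableEq X] [DecidableEq Y] in
lemma sum_nX_eq_sum_nY (R : X → Y → Prop) [∀ x y, Decidable (R x y)] (A : Finset X)
    (C : Finset Y) : ∑ y ∈ C, nX R y A = ∑ x ∈ A, nY R x C :=
  (sum_card_bipartiteAbove_eq_sum_card_bipartiteBelow R).symm

omit [DecidableEq Y] in
/-- The order of `(Z, X)` is half the number of edges at `Z`. -/
lemma ordX_univ_right (R : X → Y → Prop) [∀ x y, Decidable (R x y)] (Z : Finset X) :
    ordX R Z univ = ((∑ y : Y, nX R y Z : ℕ) : ℚ) / 2 := by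
  rw [ordX, Nat.cast_sum, sum_div]
  refine sum_congr rfl fun y _ => ?_
  have h : (nX R y Z : ℚ) ≤ nX R y univ := by exact_mod_cast nX_mono R y (subset_univ Z)
  rw [min_eq_left h, inter_univ]
  ring

omit [Fintype X] [DecidableEq Y] in
/-- The order of `(A, B)` bounds the number of edges between `A \ B` and the vertices of `Y`
having at least as many neighbours in `B` as in `A`. -/
lemma sum_nX_shiftR2_le_ordX (R : X → Y → Prop) [∀ x y, Decidable (R x y)]
    {A B Z : Finset X} (hZA : Z ⊆ A) (hZB : Disjoint Z B) :
    ((∑ y ∈ shiftR2 R A B, nX R y Z : ℕ) : ℚ) ≤ ordX R A B := by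
  have inter_le (y : Y) : (nX R y (A ∩ B) : ℚ) ≤ min (nX R y A : ℚ) (nX R y B) :=
    le_min (by exact_mod_cast nX_mono R y inter_subset_left)
      (by exact_mod_cast nX_mono R y inter_subset_right)
  rw [ordX, Nat.cast_sum]
  refine (sum_le_sum fun y hy => ?_).trans
    (sum_le_sum_of_subset_of_nonneg (subset_univ (shiftR2 R A B)) fun y _ _ => ?_)
  · have hAB : (nX R y A : ℚ) ≤ nX R y B := by exact_mod_cast (mem_filter.mp hy).2
    have hdisj : Disjoint Z (A ∩ B) := hZB.mono_right inter_subset_right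
    have hadd : nX R y Z + nX R y (A ∩ B) ≤ nX R y A := by
      rw [nX, nX, ← card_union_of_disjoint (disjoint_filter_filter hdisj), ← filter_union]
      exact nX_mono R y (union_subset hZA inter_subset_left)
    have hadd' : (nX R y Z : ℚ) + nX R y (A ∩ B) ≤ nX R y A := by exact_mod_cast hadd
    rw [min_eq_left hAB]
    have : (0 : ℚ) ≤ nX R y (A ∩ B) := Nat.cast_nonneg _
    linarith
  · have := inter_le y
    have : (0 : ℚ) ≤ nX R y (A ∩ B) := Nat.cast_nonneg _
    linarith

omit [DecidableEq X] in
/-- A vertex outside `C^◁_D` has at least half of its neighbours in `D`. -/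
lemma nY_univ_le_of_notMem_shiftL1 (R : X → Y → Prop) [∀ x y, Decidable (R x y)]
    {C D : Finset Y} (hCD : C ∪ D = univ) {x : X} (hx : x ∉ shiftL1 R C D) :
    nY R x univ ≤ 2 * nY R x D := by
  have hlt : nY R x C < nY R x D := by simpa [shiftL1] using hx
  have hle : nY R x univ ≤ nY R x C + nY R x D := by
    rw [nY, ← hCD, filter_union]
    exact card_union_le _ _
  omega

/-- Shifting a tangle of `S_{16k}(X)` to `Y` and back yields a restriction of the
original tangle. -/
theorem tangle_double_shift (R : X → Y → Prop) [∀ x y, Decidable (R x y)] (k : ℚ) (hk : 0 < k)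
    (hdegX : ∀ x : X, ∃ y : Y, R x y) (hdegY : ∀ y : Y, ∃ x : X, R x y)
    (hE : 32 * k ≤ (Fintype.card (Edge R) : ℚ))
    (τ : Set (Finset X × Finset X)) (hτ : IsTangle (ordX R) (16 * k) τ) :
    pullX R (pullY R τ ∩ Sk (ordY R) (4 * k)) ∩ Sk (ordX R) k ⊆ τ := by
  rintro ⟨A, B⟩ ⟨⟨hAB, ⟨hCD, hA'⟩, -⟩, -, hord⟩
  obtain ⟨-, hτ_or, hτ_cover⟩ := hτ
  dsimp only at hAB hCD hA' hord
  by_contra hnot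
  have hBA : (B, A) ∈ τ := by
    by_contra h
    exact hnot ((hτ_or A B hAB (by linarith)).mpr h)
  set C := shiftR1 R A B
  set D := shiftR2 R A B
  set A' := shiftL1 R C D
  set Z := univ \ (B ∪ A')
  have hZB : Disjoint Z B := disjoint_sdiff_self_left.mono_right subset_union_left
  have hZA : Z ⊆ A := fun x hx => by
    have hx' : x ∈ A ∪ B := hAB ▸ mem_univ x
    exact (mem_union.mp hx').resolve_right (disjoint_left.mp hZB hx)
  have hedges : ∑ y : Y, nX R y Z ≤ 2 * ∑ y ∈ D, nX R y Z := by
    rw [sum_nX_eq_sum_nY, sum_nX_eq_sum_nY, mul_sum]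
    refine sum_le_sum fun x hx => nY_univ_le_of_notMem_shiftL1 R hCD fun hxA' => ?_
    exact (mem_sdiff.mp hx).2 (mem_union_right _ hxA')
  have hZord : ordX R Z univ < 16 * k := by
    have hle : ((∑ y : Y, nX R y Z : ℕ) : ℚ) ≤ 2 * ((∑ y ∈ D, nX R y Z : ℕ) : ℚ) := by
      exact_mod_cast hedges
    have := sum_nX_shiftR2_le_ordX R hZA hZB
    rw [ordX_univ_right]
    linarith
  have hZτ : (Z, univ) ∈ τ := (hτ_or Z univ (by simp) hZord).mpr fun h =>
    hτ_cover _ h _ h _ h (by simp)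
  exact hτ_cover _ hBA _ hA' _ hZτ (union_sdiff_of_subset (subset_univ (B ∪ A')))

end BipSep
end
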